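/- arXiv:1912.05366 — 4 statements merged into one kernel-verified Lean document; each statement's English description precedes it below -/
import Mathlib

section
/- Let (u_n)_{n∈ℕ} be a sequence of non-negative real numbers and let K > 0, ρ > 0 and α > 1 be real numbers. If u_{n+1} ≤ K · ρ^n · u_n^α for all n ∈ ℕ, then for all n ∈ ℕ one has 0 ≤ u_n ≤ (u_0 · ρ^{1/(α−1)²} · K^{1/(α−1)})^{α^n} · ρ^{−(n(α−1)+1)/(α−1)²} · K^{−1/(α−1)}. -/
/-- De Giorgi-type iteration lemma: explicit bound for a sequence satisfying
`u (n+1) ≤ K * ρ^n * (u n)^α`. -/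
theorem iteration_lemma_bound
    (u : ℕ → ℝ) (K ρ α : ℝ)
    (hu : ∀ n, 0 ≤ u n) (hK : 0 < K) (hρ : 0 < ρ) (hα : 1 < α)
    (hrec : ∀ n, u (n + 1) ≤ K * ρ ^ n * u n ^ α) :
    ∀ n : ℕ, 0 ≤ u n ∧
      u n ≤ (u 0 * ρ ^ (1 / (α - 1) ^ 2) * K ^ (1 / (α - 1))) ^ (α ^ n) *
        ρ ^ (-((n : ℝ) * (α - 1) + 1) / (α - 1) ^ 2) * K ^ (-(1 / (α - 1))) := by
  intro n
  refine ⟨hu n, ?_⟩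
  have hα' : α - 1 ≠ 0 := by linarith
  have hu0 := hu 0
  induction n with
  | zero =>
    have hρ1 : ρ ^ (1 / (α - 1) ^ 2) * ρ ^ (-(((0 : ℕ) : ℝ) * (α - 1) + 1) / (α - 1) ^ 2) = 1 := by
      rw [← Real.rpow_add hρ, Nat.cast_zero, zero_mul, zero_add, neg_div, add_neg_cancel,
        Real.rpow_zero]
    have hK1 : K ^ (1 / (α - 1)) * K ^ (-(1 / (α - 1))) = 1 := by
      rw [← Real.rpow_add hK, add_neg_cancel, Real.rpow_zero]
    rw [pow_zero, Real.rpow_one]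
    refine le_of_eq ?_
    linear_combination (-u 0 * K ^ (1 / (α - 1)) * K ^ (-(1 / (α - 1)))) * hρ1 - u 0 * hK1
  | succ n ih =>
    set A := u 0 * ρ ^ (1 / (α - 1) ^ 2) * K ^ (1 / (α - 1)) with hA
    have hA0 : 0 ≤ A := by positivity
    have hρe : ρ ^ (-(((n + 1 : ℕ) : ℝ) * (α - 1) + 1) / (α - 1) ^ 2) =
        ρ ^ n * ρ ^ (-((n : ℝ) * (α - 1) + 1) / (α - 1) ^ 2 * α) := by
      rw [← Real.rpow_natCast ρ n, ← Real.rpow_add hρ]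
      congr 1
      push_cast
      field_simp
      ring
    have hKe : K ^ (-(1 / (α - 1))) = K * K ^ (-(1 / (α - 1)) * α) := by
      nth_rewrite 2 [← Real.rpow_one K]
      rw [← Real.rpow_add hK]
      congr 1
      field_simp
      ring
    calc u (n + 1) ≤ K * ρ ^ n * u n ^ α := hrec n
      _ ≤ K * ρ ^ n * (A ^ (α ^ n) * ρ ^ (-((n : ℝ) * (α - 1) + 1) / (α - 1) ^ 2) *
            K ^ (-(1 / (α - 1)))) ^ α := by
          have := Real.rpow_le_rpow (hu n) ih (by linarith : 0 ≤ α)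
          gcongr
      _ = _ := by
          rw [Real.mul_rpow (by positivity) (by positivity),
            Real.mul_rpow (by positivity) (by positivity), ← Real.rpow_mul hA0,
            ← Real.rpow_mul hρ.le, ← Real.rpow_mul hK.le, hρe, hKe, ← pow_succ]
          ring
end

section
/- Let K > 0 and let (E_m)_{m≥1} be a sequence of non-negative real numbers satisfying E_{m+1} ≤ K · 8^m · E_m^{3/2} for all m ≥ 1. If E_1 ≤ 8^{−6} · K^{−2}, then the sequence (E_m) converges to 0. -/
/-- Squaring and raising to the power `3/2` amounts to cubing. -/
theorem sq_rpow_three_halves {r : ℝ} (hr : 0 ≤ r) : (r ^ 2) ^ (3 / 2 : ℝ) = r ^ 3 := by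
  rw [← Real.rpow_natCast r 2, ← Real.rpow_mul hr, ← Real.rpow_natCast r 3]
  norm_num

/-- Geometric decay of the De Giorgi iteration: the bound `8⁻⁴ K⁻² 64⁻ᵐ` propagates. -/
theorem deGiorgi_energy_le
    (E : ℕ → ℝ) (K : ℝ) (hK : 0 < K)
    (hE : ∀ m, 1 ≤ m → 0 ≤ E m)
    (hrec : ∀ m, 1 ≤ m → E (m + 1) ≤ K * 8 ^ m * E m ^ (3 / 2 : ℝ))
    (h1 : E 1 ≤ (8 : ℝ) ^ (-6 : ℤ) * K ^ (-2 : ℤ)) (m : ℕ) (hm : 1 ≤ m) :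
    E m ≤ ((64 * K)⁻¹ * (8⁻¹) ^ m) ^ 2 := by
  induction m, hm using Nat.le_induction with
  | base =>
    refine h1.trans_eq ?_
    simp only [zpow_neg, pow_one]
    norm_cast
    field_simp
    norm_num
  | succ m hm ih =>
    have hr : 0 ≤ (64 * K)⁻¹ * (8⁻¹ : ℝ) ^ m := by positivity
    calc E (m + 1) ≤ K * 8 ^ m * E m ^ (3 / 2 : ℝ) := hrec m hm
      _ ≤ K * 8 ^ m * (((64 * K)⁻¹ * (8⁻¹) ^ m) ^ 2) ^ (3 / 2 : ℝ) := by
        gcongr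
        exact hE m hm
      _ = ((64 * K)⁻¹ * (8⁻¹) ^ (m + 1)) ^ 2 := by
        rw [sq_rpow_three_halves hr, pow_succ _ m, inv_pow]
        field_simp
        norm_num

/-- De Giorgi iteration with exponent `α = 3/2` and factor `ρ = 8`: if
`E 1 ≤ 8⁻⁶ K⁻²` then `E m → 0`. -/
theorem deGiorgi_energy_tendsto_zero
    (E : ℕ → ℝ) (K : ℝ) (hK : 0 < K)
    (hE : ∀ m, 1 ≤ m → 0 ≤ E m)
    (hrec : ∀ m, 1 ≤ m → E (m + 1) ≤ K * 8 ^ m * E m ^ (3 / 2 : ℝ))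
    (h1 : E 1 ≤ (8 : ℝ) ^ (-6 : ℤ) * K ^ (-2 : ℤ)) :
    Filter.Tendsto E Filter.atTop (nhds 0) := by
  have hlim : Filter.Tendsto (fun m : ℕ => ((64 * K)⁻¹ * (8⁻¹ : ℝ) ^ m) ^ 2)
      Filter.atTop (nhds 0) := by
    have hpow : Filter.Tendsto (fun m : ℕ => (8⁻¹ : ℝ) ^ m) Filter.atTop (nhds 0) :=
      tendsto_pow_atTop_nhds_zero_of_lt_one (by norm_num) (by norm_num)
    simpa using (hpow.const_mul (64 * K)⁻¹).pow 2
  refine tendsto_of_tendsto_of_tendsto_of_le_of_le' tendsto_const_nhds hlim ?_ ?_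
  · filter_upwards [Filter.eventually_ge_atTop 1] with m hm using hE m hm
  · filter_upwards [Filter.eventually_ge_atTop 1] with m hm
      using deGiorgi_energy_le E K hK hE hrec h1 m hm
end

section
/- Let φ : ℝ → ℝ be defined by φ(s) = s/(1+s) for s ≥ 0 and φ(s) = 0 for s < 0. Then for all real numbers x and y one has (log(1 + x⁺) − log(1 + y⁺))² ≤ (x⁺ − y⁺)·(φ(x) − φ(y)), where s⁺ = max(s, 0) denotes the positive part of s. -/
theorem Real.sq_le_sinh_sq (t : ℝ) : t ^ 2 ≤ Real.sinh t ^ 2 := by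
  rw [sq_le_sq, Real.abs_sinh]
  exact Real.self_le_sinh_iff.2 (abs_nonneg t)

theorem Real.sq_log_sub_log_le {a b : ℝ} (ha : 0 < a) (hb : 0 < b) :
    (Real.log a - Real.log b) ^ 2 ≤ (a - b) ^ 2 / (a * b) := by
  have key : ∀ u v : ℝ,
      (u - v) ^ 2 ≤ (Real.exp u - Real.exp v) ^ 2 / (Real.exp u * Real.exp v) := by
    intro u v
    have h := Real.sq_le_sinh_sq ((u - v) / 2)
    have hsinh : 4 * Real.sinh ((u - v) / 2) ^ 2 =
        (Real.exp u - Real.exp v) ^ 2 / (Real.exp u * Real.exp v) := by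
      have hu : Real.exp u = Real.exp (u / 2) ^ 2 := by
        rw [← Real.exp_nat_mul]; congr 1; push_cast; ring
      have hv : Real.exp v = Real.exp (v / 2) ^ 2 := by
        rw [← Real.exp_nat_mul]; congr 1; push_cast; ring
      rw [sub_div, Real.sinh_eq, Real.exp_neg, Real.exp_sub, hu, hv]
      field_simp
      ring
    linarith
  simpa only [Real.exp_log ha, Real.exp_log hb] using key (Real.log a) (Real.log b)

/-- Pointwise inequality showing `E_m ≤ F_m`:
`(log(1+x⁺) - log(1+y⁺))² ≤ (x⁺ - y⁺)(φ(x) - φ(y))`. -/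
theorem log_sq_le_phi
    (φ : ℝ → ℝ)
    (hφ1 : ∀ s : ℝ, 0 ≤ s → φ s = s / (1 + s))
    (hφ2 : ∀ s : ℝ, s < 0 → φ s = 0) :
    ∀ x y : ℝ,
      (Real.log (1 + max x 0) - Real.log (1 + max y 0)) ^ 2 ≤
        (max x 0 - max y 0) * (φ x - φ y) := by
  have hφ : ∀ s : ℝ, φ s = max s 0 / (1 + max s 0) := by
    intro s
    rcases lt_or_ge s 0 with hs | hs
    · simp [hφ2 s hs, max_eq_right hs.le]
    · rw [hφ1 s hs, max_eq_left hs]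
  intro x y
  have hx : 0 < 1 + max x 0 := by positivity
  have hy : 0 < 1 + max y 0 := by positivity
  refine (Real.sq_log_sub_log_le hx hy).trans_eq ?_
  rw [hφ x, hφ y]
  field_simp
  ring
end

section
/- Let φ : ℝ → ℝ be defined by φ(s) = s/(1+s) for s ≥ 0 and φ(s) = 0 for s < 0, and let C be a real number with 0 ≤ C ≤ 2. Then for all real numbers x and y with x ≥ y one has (y + C)·(φ(x) − φ(y)) ≤ 2·(x⁺ − y⁺)/(√(1 + x⁺)·√(1 + y⁺)), where s⁺ = max(s, 0) denotes the positive part of s. -/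
/-- Pointwise estimate for the convective term in the De Giorgi energy
estimate: for `0 ≤ C ≤ 2` and `x ≥ y`,
`(y + C)(φ(x) - φ(y)) ≤ 2 (x⁺ - y⁺)/(√(1+x⁺)·√(1+y⁺))`. -/
theorem convective_pointwise_estimate
    (φ : ℝ → ℝ)
    (hφ1 : ∀ s : ℝ, 0 ≤ s → φ s = s / (1 + s))
    (hφ2 : ∀ s : ℝ, s < 0 → φ s = 0)
    (C : ℝ) (hC0 : 0 ≤ C) (hC2 : C ≤ 2) :
    ∀ x y : ℝ, y ≤ x →
      (y + C) * (φ x - φ y) ≤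
        2 * (max x 0 - max y 0) /
          (Real.sqrt (1 + max x 0) * Real.sqrt (1 + max y 0)) := by
  intro x y hxy
  have hφ : ∀ s : ℝ, φ s = max s 0 / (1 + max s 0) := by
    intro s
    rcases le_or_gt 0 s with hs | hs
    · rw [hφ1 s hs, max_eq_left hs]
    · rw [hφ2 s hs, max_eq_right hs.le, zero_div]
  have hyb : y ≤ max y 0 := le_max_left y 0
  have hb : 0 ≤ max y 0 := le_max_right y 0
  have hba : max y 0 ≤ max x 0 := max_le_max_right 0 hxy
  rw [hφ x, hφ y]
  generalize max x 0 = a at *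
  generalize max y 0 = b at *
  have ha1 : 0 < 1 + a := by linarith
  have hb1 : 0 < 1 + b := by linarith
  rw [← Real.sqrt_mul ha1.le]
  have hP : 1 + b ≤ √((1 + a) * (1 + b)) := Real.le_sqrt_of_sq_le (by nlinarith)
  have hP0 : 0 < √((1 + a) * (1 + b)) := hb1.trans_le hP
  have hsq : √((1 + a) * (1 + b)) ^ 2 = (1 + a) * (1 + b) := Real.sq_sqrt (by positivity)
  have hdiff : a / (1 + a) - b / (1 + b) = (a - b) / √((1 + a) * (1 + b)) ^ 2 := by
    rw [hsq]
    field_simp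
    ring
  rw [hdiff]
  generalize √((1 + a) * (1 + b)) = P at *
  calc (y + C) * ((a - b) / P ^ 2)
      ≤ 2 * P * ((a - b) / P ^ 2) :=
        mul_le_mul_of_nonneg_right (by linarith)
          (div_nonneg (by linarith) (by positivity))
    _ = 2 * (a - b) / P := by field_simp
end
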